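/- There exists a constant $\alpha_0 > 0$ such that for every $\alpha \ge \alpha_0$ and every $r > 2M$ one has $2\,f^b(r)\,\frac{r - 3M}{r^4} + F(r) \ge 0$. -/

import Mathlib

/-- The Regge–Wheeler (tortoise) coordinate. -/
noncomputable def rstar (M r : ℝ) : ℝ :=
  r + 2 * M * Real.log (r - 2 * M) - 3 * M - 2 * M * Real.log M

/-- x = r* - α - α^{1/2}. -/
noncomputable def xx (M α r : ℝ) : ℝ := rstar M r - α - Real.sqrt α

/-- f^b = α⁻¹ (arctan(x/α) - arctan(-1 - α^{-1/2})). -/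
noncomputable def fb (M α r : ℝ) : ℝ :=
  α⁻¹ * (Real.arctan (xx M α r / α) - Real.arctan (-1 - (Real.sqrt α)⁻¹))


/-- μ = 2M/r. -/
noncomputable def mu (M r : ℝ) : ℝ := 2 * M / r

/-- F = (1/(2(1-μ))) (x² - α²)/((x² + α²)³). -/
noncomputable def FF (M α r : ℝ) : ℝ :=
  1 / (2 * (1 - mu M r)) * (((xx M α r) ^ 2 - α ^ 2) / ((xx M α r) ^ 2 + α ^ 2) ^ 3)

lemma div_le_arctan_sub_arctan {a u v : ℝ} (hu : -a ≤ u) (huv : u ≤ v) (hv : v ≤ a) :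
    (v - u) / (1 + a ^ 2) ≤ Real.arctan v - Real.arctan u := by
  have h := (convex_Icc (-a) a).mul_sub_le_image_sub_of_le_deriv
    (f := Real.arctan) (C := 1 / (1 + a ^ 2)) Real.continuous_arctan.continuousOn
    Real.differentiable_arctan.differentiableOn (by
      intro y hy
      rw [interior_Icc] at hy
      rw [Real.deriv_arctan]
      have : y ^ 2 ≤ a ^ 2 := sq_le_sq' hy.1.le hy.2.le
      exact one_div_le_one_div_of_le (by positivity) (by linarith)) u ⟨hu, huv.trans hv⟩ v ⟨hu.trans huv, hv⟩ huv
  calc (v - u) / (1 + a ^ 2) = 1 / (1 + a ^ 2) * (v - u) := by ring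
    _ ≤ _ := h

lemma rstar_eq {M r : ℝ} (hM : 0 < M) (hr : 2 * M < r) :
    rstar M r = r - 3 * M + 2 * M * Real.log ((r - 2 * M) / M) := by
  rw [rstar, Real.log_div (by linarith) hM.ne']
  ring

lemma rstar_le {M r : ℝ} (hM : 0 < M) (hr : 2 * M < r) : rstar M r ≤ 3 * (r - 3 * M) := by
  have hpos : 0 < (r - 2 * M) / M := div_pos (by linarith) hM
  have h := mul_le_mul_of_nonneg_left (Real.log_le_sub_one_of_pos hpos) (by linarith : 0 ≤ 2 * M)
  have e : 2 * M * ((r - 2 * M) / M - 1) = 2 * (r - 3 * M) := by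
    field_simp
    ring
  rw [rstar_eq hM hr]
  linarith

lemma le_rstar {M r : ℝ} (hM : 0 < M) (hr : 3 * M ≤ r) : r - 3 * M ≤ rstar M r := by
  have h : 1 ≤ (r - 2 * M) / M := by
    rw [le_div_iff₀ hM]
    linarith
  have h2 := mul_nonneg (by linarith : 0 ≤ 2 * M) (Real.log_nonneg h)
  rw [rstar_eq hM (by linarith)]
  linarith

lemma xx_div_eq {M α r : ℝ} (hα : 0 < α) :
    xx M α r / α = rstar M r / α - 1 - (Real.sqrt α)⁻¹ := by
  have hq : 0 < Real.sqrt α := Real.sqrt_pos.2 hα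
  have e : Real.sqrt α / α = (Real.sqrt α)⁻¹ := by
    rw [Real.sqrt_div_self', one_div]
  rw [xx, sub_div, sub_div, e, div_self hα.ne']

lemma fb_mul_nonneg {M α r : ℝ} (hM : 0 < M) (hα : 0 < α) (hr : 2 * M < r) :
    0 ≤ fb M α r * (r - 3 * M) := by
  have hα' : 0 ≤ α⁻¹ := by positivity
  rw [fb, xx_div_eq hα]
  rcases le_total (3 * M) r with h | h
  · have hR : 0 ≤ rstar M r / α := div_nonneg (by linarith [le_rstar hM h]) hα.le
    refine mul_nonneg (mul_nonneg hα' (sub_nonneg.2 (Real.arctan_mono ?_))) (by linarith)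
    linarith
  · have hR : rstar M r / α ≤ 0 :=
      div_nonpos_of_nonpos_of_nonneg (by linarith [rstar_le hM hr]) hα.le
    refine mul_nonneg_of_nonpos_of_nonpos
      (mul_nonpos_of_nonneg_of_nonpos hα' (sub_nonpos.2 (Real.arctan_mono ?_))) (by linarith)
    linarith

lemma one_sub_mu_pos {M r : ℝ} (hM : 0 < M) (hr : 2 * M < r) : 0 < 1 - mu M r := by
  rw [mu, sub_pos, div_lt_one (by linarith)]
  exact hr

lemma FF_nonneg {M α r : ℝ} (hM : 0 < M) (hr : 2 * M < r) (h : α ^ 2 ≤ xx M α r ^ 2) :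
    0 ≤ FF M α r := by
  have := one_sub_mu_pos hM hr
  have h' : 0 ≤ xx M α r ^ 2 - α ^ 2 := sub_nonneg.2 h
  rw [FF]
  positivity

lemma FF_eq {M α r : ℝ} (hα : 0 < α) :
    FF M α r = -(1 / (2 * (1 - mu M r)) *
      ((1 - (xx M α r / α) ^ 2) / (1 + (xx M α r / α) ^ 2) ^ 3) / α ^ 4) := by
  have h : xx M α r = α * (xx M α r / α) := by field_simp
  generalize xx M α r / α = s at h
  have e1 : (α * s) ^ 2 - α ^ 2 = -(α ^ 2 * (1 - s ^ 2)) := by ring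
  have e2 : ((α * s) ^ 2 + α ^ 2) ^ 3 = α ^ 6 * (1 + s ^ 2) ^ 3 := by ring
  have hs : 1 + s ^ 2 ≠ 0 := by positivity
  rw [FF, h, e1, e2]
  generalize 1 / (2 * (1 - mu M r)) = k
  field_simp

lemma sq_mul_one_sub_sq_le {s t : ℝ} (ht : 0 ≤ t) (hst : t ≤ s + 1.01) (hs : s ^ 2 ≤ 1) :
    t ^ 2 * (1 - s ^ 2) ≤ 1.88 * (1 + s ^ 2) ^ 3 := by
  have h1 : t ^ 2 ≤ 5 * s ^ 2 + 1.28 := by nlinarith [sq_nonneg (4 * s - 1.01)]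
  have h2 : t ^ 2 * (1 - s ^ 2) ≤ (5 * s ^ 2 + 1.28) * (1 - s ^ 2) :=
    mul_le_mul_of_nonneg_right h1 (by linarith)
  have hw : 0 ≤ s ^ 2 := sq_nonneg s
  generalize s ^ 2 = w at *
  nlinarith [mul_nonneg hw hw, mul_nonneg (mul_nonneg hw hw) hw]

theorem stmt_15 (M : ℝ) (hM : 0 < M) :
    ∃ α₀ > (0:ℝ), ∀ α ≥ α₀, ∀ r, 2 * M < r →
      0 ≤ 2 * fb M α r * ((r - 3 * M) / r ^ 4) + FF M α r := by
  refine ⟨(100 + 900 * M) ^ 2, by positivity, fun α hα r hr => ?_⟩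
  have hq : 100 + 900 * M ≤ Real.sqrt α := Real.le_sqrt_of_sq_le hα
  have hα0 : 0 < α := lt_of_lt_of_le (by positivity) hα
  have hr0 : 0 < r := by linarith
  rcases le_or_gt (α ^ 2) (xx M α r ^ 2) with h | h
  · have h1 := fb_mul_nonneg hM hα0 hr
    have h2 := FF_nonneg hM hr h
    have e : 2 * fb M α r * ((r - 3 * M) / r ^ 4) = 2 * (fb M α r * (r - 3 * M)) / r ^ 4 := by
      ring
    rw [e]
    positivity
  have hx := abs_lt.1 (abs_lt_of_sq_lt_sq h hα0.le)
  have hR : Real.sqrt α < rstar M r := by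
    have := hx.1
    rw [xx] at this
    linarith
  have hRr := rstar_le hM hr
  have hr3 : 3 * M ≤ 0.01 * r := by linarith
  have hrR := le_rstar hM (by linarith : 3 * M ≤ r)
  have hr1 : r ≤ 1.01 * rstar M r := by linarith
  have hs1 : xx M α r / α < 1 := (div_lt_one hα0).2 hx.2
  have hs2 : -1 < xx M α r / α := by
    rw [lt_div_iff₀ hα0]
    linarith
  have hst := xx_div_eq (M := M) (r := r) hα0
  have hδ0 : 0 < (Real.sqrt α)⁻¹ := inv_pos.2 (by linarith)
  have hδ : (Real.sqrt α)⁻¹ ≤ 0.01 := by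
    rw [inv_le_comm₀ (by linarith) (by norm_num)]
    norm_num
    linarith
  have hmu : 0.99 ≤ 1 - mu M r := by
    have : mu M r ≤ 0.01 := by
      rw [mu, div_le_iff₀ hr0]
      linarith
    linarith
  have hRt : rstar M r = α * (rstar M r / α) := by field_simp
  rw [FF_eq hα0, fb]
  rw [hRt] at hr1
  have ht : 0 < rstar M r / α := div_pos (by linarith) hα0
  generalize xx M α r / α = s at *
  generalize rstar M r / α = t at *
  generalize (Real.sqrt α)⁻¹ = δ at *
  have hA : t / 2.0201 ≤ Real.arctan s - Real.arctan (-1 - δ) := by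
    have := div_le_arctan_sub_arctan (a := 1.01) (u := -1 - δ) (v := s)
      (by linarith) (by linarith) (by linarith)
    rw [hst] at this ⊢
    norm_num at this ⊢
    linarith
  have hs : s ^ 2 ≤ 1 := by nlinarith
  have hpoly := sq_mul_one_sub_sq_le ht.le (by linarith : t ≤ s + 1.01) hs
  generalize Real.arctan s - Real.arctan (-1 - δ) = A at *
  have hA0 : 0 < A := lt_of_lt_of_le (by positivity) hA
  have hfirst : 0.95 / t ^ 2 / α ^ 4 ≤
      2 * (α⁻¹ * A) * ((r - 3 * M) / r ^ 4) := by
    calc 0.95 / t ^ 2 / α ^ 4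
        ≤ 2 * (α⁻¹ * (t / 2.0201)) * (0.99 / (1.01 * (α * t)) ^ 3) := by
          have e : 2 * (α⁻¹ * (t / 2.0201)) * (0.99 / (1.01 * (α * t)) ^ 3)
              = (2 * 0.99 / 2.0201 / 1.01 ^ 3) / t ^ 2 / α ^ 4 := by
            field_simp
          rw [e]
          gcongr
          norm_num
      _ ≤ 2 * (α⁻¹ * (t / 2.0201)) * (0.99 / r ^ 3) := by gcongr
      _ = 2 * (α⁻¹ * (t / 2.0201)) * (0.99 * r / r ^ 4) := by field_simp
      _ ≤ _ := by
          gcongr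
          linarith
  have hsecond : 1 / (2 * (1 - mu M r)) * ((1 - s ^ 2) / (1 + s ^ 2) ^ 3) / α ^ 4
      ≤ 0.95 / t ^ 2 / α ^ 4 := by
    have h1 : (1 - s ^ 2) / (1 + s ^ 2) ^ 3 ≤ 1.88 / t ^ 2 := by
      rw [div_le_div_iff₀ (by positivity) (by positivity)]
      linarith
    have h2 : 1 / (2 * (1 - mu M r)) ≤ 1 / (2 * 0.99) := by gcongr
    have h3 : 0 ≤ (1 - s ^ 2) / (1 + s ^ 2) ^ 3 := div_nonneg (by linarith) (by positivity)
    gcongr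
    calc _ ≤ 1 / (2 * 0.99) * (1.88 / t ^ 2) := by gcongr
      _ = (1.88 / (2 * 0.99)) / t ^ 2 := by ring
      _ ≤ _ := by
        gcongr
        norm_num
  linarith
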